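/- Let d ≥ 1, let μ ∈ ℝ^d, and let c > 0 and σ > 0. Let P = ⊗_{i=1}^d N(μ_i, c²) and Q = ⊗_{i=1}^d N(μ_i, c² + σ²) be product Gaussian measures on ℝ^d. Then (1/100) · min{1, (σ²/c²)·√d} ≤ TV(P, Q) ≤ (3/2) · min{1, (σ²/c²)·√d}. Consequently, the privacy leakage ε_p := 1 − TV(P, Q) of the Randomization mechanism satisfies 1 − (3/2)·min{1, (σ²/c²)·√d} ≤ ε_p ≤ 1 − (1/100)·min{1, (σ²/c²)·√d}. -/

import Mathlib

open MeasureTheory ProbabilityTheory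

/-- The total variation distance between two measures:
`TV(P,Q) = sup { |P(S) − Q(S)| : S measurable }`. -/
noncomputable def tvDist {Ω : Type*} [MeasurableSpace Ω] (P Q : Measure Ω) : ℝ :=
  ⨆ S : {S : Set Ω // MeasurableSet S}, |(P S.1).toReal - (Q S.1).toReal|

/-! ### Total variation and densities -/

section Density

variable {Ω : Type*} [MeasurableSpace Ω] {P Q : Measure Ω} {f h : Ω → ℝ}

theorem sq_integral_mul_le_integral_sq_mul_integral_sq {u v : Ω → ℝ}
    (hu : MemLp u 2 Q) (hv : MemLp v 2 Q) :
    (∫ x, u x * v x ∂Q) ^ 2 ≤ (∫ x, u x ^ 2 ∂Q) * ∫ x, v x ^ 2 ∂Q := by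
  have huv : Integrable (fun x => u x * v x) Q := hu.integrable_mul hv
  have key : ∀ t : ℝ, 0 ≤ (∫ x, v x ^ 2 ∂Q) * (t * t) + (-2 * ∫ x, u x * v x ∂Q) * t
      + ∫ x, u x ^ 2 ∂Q := fun t => by
    have h0 : 0 ≤ ∫ x, (u x - t * v x) ^ 2 ∂Q := integral_nonneg fun x => sq_nonneg _
    have h1 : ∫ x, (u x - t * v x) ^ 2 ∂Q
        = ∫ x, (t * t * v x ^ 2 + (-2 * t) * (u x * v x) + u x ^ 2) ∂Q :=
      integral_congr_ae (ae_of_all _ fun x => by ring)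
    rw [integral_add (by exact (hv.integrable_sq.const_mul _).add (huv.const_mul _))
        hu.integrable_sq, integral_add (hv.integrable_sq.const_mul _) (huv.const_mul _),
      integral_const_mul, integral_const_mul] at h1
    linarith
  have := discrim_le_zero key
  unfold discrim at this
  linarith

theorem bddAbove_range_abs_measure_sub [IsProbabilityMeasure P] [IsProbabilityMeasure Q] :
    BddAbove (Set.range fun S : {S : Set Ω // MeasurableSet S} =>
      |(P S.1).toReal - (Q S.1).toReal|) := by
  refine ⟨1, ?_⟩
  rintro _ ⟨S, rfl⟩
  exact abs_sub_le_of_nonneg_of_le measureReal_nonneg measureReal_le_one measureReal_nonneg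
    measureReal_le_one

theorem tvDist_le_one [IsProbabilityMeasure P] [IsProbabilityMeasure Q] : tvDist P Q ≤ 1 :=
  Real.iSup_le (fun _ => abs_sub_le_of_nonneg_of_le measureReal_nonneg measureReal_le_one
    measureReal_nonneg measureReal_le_one) zero_le_one

theorem toReal_withDensity_sub_toReal [IsFiniteMeasure Q] (hf : Integrable f Q)
    (hf0 : ∀ x, 0 ≤ f x) {S : Set Ω} (hS : MeasurableSet S) :
    (Q.withDensity (fun x => ENNReal.ofReal (f x)) S).toReal - (Q S).toReal
      = ∫ x in S, (f x - 1) ∂Q := by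
  rw [withDensity_apply _ hS, ← integral_eq_lintegral_of_nonneg_ae (ae_of_all _ hf0)
    hf.aestronglyMeasurable.restrict, integral_sub hf.integrableOn (integrable_const _)]
  simp [Measure.real]

variable [IsProbabilityMeasure P] [IsProbabilityMeasure Q]

theorem integral_eq_one_of_withDensity (hf : Integrable f Q) (hf0 : ∀ x, 0 ≤ f x)
    (hP : P = Q.withDensity fun x => ENNReal.ofReal (f x)) : ∫ x, f x ∂Q = 1 := by
  have h := toReal_withDensity_sub_toReal hf hf0 MeasurableSet.univ
  rw [← hP, setIntegral_univ, integral_sub hf (integrable_const _)] at h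
  simp at h
  linarith

theorem integral_sub_one_sq (hf : MemLp f 2 Q) (hf0 : ∀ x, 0 ≤ f x)
    (hP : P = Q.withDensity fun x => ENNReal.ofReal (f x)) :
    ∫ x, (f x - 1) ^ 2 ∂Q = (∫ x, f x ^ 2 ∂Q) - 1 := by
  have hfi : Integrable f Q := hf.integrable one_le_two
  have h1 : ∫ x, (f x - 1) ^ 2 ∂Q = ∫ x, (f x ^ 2 - 2 * f x + 1) ∂Q :=
    integral_congr_ae (ae_of_all _ fun x => by ring)
  rw [h1, integral_add (by exact hf.integrable_sq.sub (hfi.const_mul 2)) (integrable_const _),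
    integral_sub hf.integrable_sq (hfi.const_mul 2), integral_const_mul,
    integral_eq_one_of_withDensity hfi hf0 hP]
  simp
  ring

theorem tvDist_le_sqrt_integral_sq_sub_one (hf : MemLp f 2 Q) (hf0 : ∀ x, 0 ≤ f x)
    (hP : P = Q.withDensity fun x => ENNReal.ofReal (f x)) :
    tvDist P Q ≤ √((∫ x, f x ^ 2 ∂Q) - 1) := by
  have hfi : Integrable f Q := hf.integrable one_le_two
  have hg : MemLp (fun x => f x - 1) 2 Q := hf.sub (memLp_const 1)
  have hχ : ∫ x, (f x - 1) ^ 2 ∂Q = (∫ x, f x ^ 2 ∂Q) - 1 :=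
    integral_sub_one_sq hf hf0 hP
  refine Real.iSup_le (fun S => ?_) (Real.sqrt_nonneg _)
  refine Real.abs_le_sqrt ?_
  rw [hP, toReal_withDensity_sub_toReal hfi hf0 S.2, ← integral_indicator S.2, ← hχ]
  have hind : MemLp (S.1.indicator fun _ => (1 : ℝ)) 2 Q :=
    (memLp_const 1).indicator S.2
  have hone : ∫ x, (S.1.indicator (fun _ => (1 : ℝ)) x) ^ 2 ∂Q ≤ 1 := by
    calc ∫ x, (S.1.indicator (fun _ => (1 : ℝ)) x) ^ 2 ∂Q ≤ ∫ _, (1 : ℝ) ∂Q := by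
          refine integral_mono hind.integrable_sq (integrable_const _) fun x => ?_
          by_cases hx : x ∈ S.1 <;> simp [hx]
      _ = 1 := by simp
  have hmul : ∫ x, S.1.indicator (fun x => f x - 1) x ∂Q
      = ∫ x, (f x - 1) * S.1.indicator (fun _ => (1 : ℝ)) x ∂Q :=
    integral_congr_ae (ae_of_all _ fun x => by by_cases hx : x ∈ S.1 <;> simp [hx])
  rw [hmul]
  refine (sq_integral_mul_le_integral_sq_mul_integral_sq hg hind).trans ?_
  exact mul_le_of_le_one_right (integral_nonneg fun x => sq_nonneg _) hone

theorem integral_posPart_le_tvDist (hfm : Measurable f) (hf : Integrable f Q) (hf0 : ∀ x, 0 ≤ f x)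
    (hP : P = Q.withDensity fun x => ENNReal.ofReal (f x)) :
    ∫ x, max (f x - 1) 0 ∂Q ≤ tvDist P Q := by
  have hS : MeasurableSet {x | 1 ≤ f x} := measurableSet_le measurable_const hfm
  have h1 : ∫ x, max (f x - 1) 0 ∂Q = (P {x | 1 ≤ f x}).toReal - (Q {x | 1 ≤ f x}).toReal := by
    rw [hP, toReal_withDensity_sub_toReal hf hf0 hS, ← integral_indicator hS]
    refine integral_congr_ae (ae_of_all _ fun x => ?_)
    by_cases hx : 1 ≤ f x
    · simp [hx]
    · simp [hx, le_of_not_ge hx]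
  rw [h1]
  exact (le_abs_self _).trans (le_ciSup (bddAbove_range_abs_measure_sub (P := P) (Q := Q))
    ⟨{x | 1 ≤ f x}, hS⟩)

theorem one_sub_integral_sqrt_le_tvDist (hfm : Measurable f) (hf : Integrable f Q)
    (hf0 : ∀ x, 0 ≤ f x) (hP : P = Q.withDensity fun x => ENNReal.ofReal (f x)) :
    1 - ∫ x, √(f x) ∂Q ≤ tvDist P Q := by
  have hsqrt : Integrable (fun x => √(f x)) Q := by
    refine (hf.add (integrable_const 1)).mono' hfm.sqrt.aestronglyMeasurable
      (ae_of_all _ fun x => ?_)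
    rw [Real.norm_of_nonneg (Real.sqrt_nonneg _)]
    simp only [Pi.add_apply]
    nlinarith [Real.sq_sqrt (hf0 x), sq_nonneg (√(f x) - 1)]
  have hpos : Integrable (fun x => max (f x - 1) 0) Q := (hf.sub (integrable_const 1)).pos_part
  have hle : ∫ x, (f x - √(f x)) ∂Q ≤ ∫ x, max (f x - 1) 0 ∂Q := by
    refine integral_mono (hf.sub hsqrt) hpos fun x => ?_
    rcases le_total 1 (f x) with hx | hx
    · exact le_max_of_le_left (sub_le_sub_left (Real.one_le_sqrt.2 hx) _)
    · refine le_max_of_le_right (sub_nonpos.2 ?_)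
      exact Real.le_sqrt_of_sq_le (by nlinarith [hf0 x])
  rw [integral_sub hf hsqrt, integral_eq_one_of_withDensity hf hf0 hP] at hle
  exact hle.trans (integral_posPart_le_tvDist hfm hf hf0 hP)

/-- Testing the positive part of `f - 1` against `h`, by two applications of the Cauchy–Schwarz
inequality. -/
theorem pow_four_integral_sub_le_tvDist_sq_mul {C D : ℝ} (hfm : Measurable f)
    (hhm : Measurable h) (hf0 : ∀ x, 0 ≤ f x) (hfC : ∀ x, f x ≤ C) (hh0 : ∀ x, 0 ≤ h x)
    (hhD : ∀ x, h x ≤ D) (hP : P = Q.withDensity fun x => ENNReal.ofReal (f x))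
    (hle : ∫ x, h x ∂Q ≤ ∫ x, f x * h x ∂Q) :
    ((∫ x, f x * h x ∂Q) - ∫ x, h x ∂Q) ^ 4
      ≤ tvDist P Q ^ 2 * (((∫ x, f x ^ 2 ∂Q) - 1) * ∫ x, h x ^ 4 ∂Q) := by
  have bdd : ∀ {u : Ω → ℝ} {p : ENNReal} (B : ℝ), Measurable u → (∀ x, 0 ≤ u x) → (∀ x, u x ≤ B) →
      MemLp u p Q := fun B hu h0 hB =>
    MemLp.of_bound hu.aestronglyMeasurable B
      (ae_of_all _ fun x => by rw [Real.norm_of_nonneg (h0 x)]; exact hB x)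
  have hf : MemLp f 2 Q := bdd C hfm hf0 hfC
  have hfi : Integrable f Q := hf.integrable one_le_two
  set g : Ω → ℝ := fun x => max (f x - 1) 0 with hg_def
  have hgm : Measurable g := (hfm.sub_const 1).max measurable_const
  have hg0 : ∀ x, 0 ≤ g x := fun x => le_max_right _ _
  have hgC : ∀ x, g x ≤ C := fun x =>
    max_le (by linarith [hfC x]) ((hf0 x).trans (hfC x))
  have hsg0 : ∀ x, 0 ≤ √(g x) := fun x => Real.sqrt_nonneg _
  have hh2 : ∀ x, h x ^ 2 ≤ D ^ 2 := fun x => pow_le_pow_left₀ (hh0 x) (hhD x) 2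
  have hg2 : MemLp g 2 Q := bdd C hgm hg0 hgC
  have hh : MemLp h 2 Q := bdd D hhm hh0 hhD
  have hhsq : MemLp (fun x => h x ^ 2) 2 Q :=
    bdd (D ^ 2) (hhm.pow_const 2) (fun x => sq_nonneg _) hh2
  have hsg : MemLp (fun x => √(g x)) 2 Q :=
    bdd (√C) hgm.sqrt hsg0 fun x => Real.sqrt_le_sqrt (hgC x)
  have hsgh : MemLp (fun x => √(g x) * h x) 2 Q :=
    bdd (√C * D) (hgm.sqrt.mul hhm) (fun x => mul_nonneg (hsg0 x) (hh0 x)) fun x =>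
      mul_le_mul (Real.sqrt_le_sqrt (hgC x)) (hhD x) (hh0 x) (Real.sqrt_nonneg _)
  have hfh : Integrable (fun x => f x * h x) Q := hf.integrable_mul hh
  have hgh : Integrable (fun x => g x * h x) Q := hg2.integrable_mul hh
  have hhi : Integrable h Q := hh.integrable one_le_two
  have hfgh : (∫ x, f x * h x ∂Q) - ∫ x, h x ∂Q ≤ ∫ x, g x * h x ∂Q := by
    rw [← integral_sub hfh hhi]
    refine integral_mono (hfh.sub hhi) hgh fun x => ?_
    have := mul_le_mul_of_nonneg_right (le_max_left (f x - 1) 0) (hh0 x)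
    simp only [hg_def]
    linarith
  have hgh_sq : (∫ x, g x * h x ∂Q) ^ 2 ≤ (∫ x, g x ∂Q) * ∫ x, g x * h x ^ 2 ∂Q := by
    have := sq_integral_mul_le_integral_sq_mul_integral_sq hsg hsgh
    simpa only [← mul_assoc, Real.mul_self_sqrt (hg0 _), mul_pow, Real.sq_sqrt (hg0 _)] using this
  have hghh_sq : (∫ x, g x * h x ^ 2 ∂Q) ^ 2 ≤ (∫ x, g x ^ 2 ∂Q) * ∫ x, h x ^ 4 ∂Q := by
    have := sq_integral_mul_le_integral_sq_mul_integral_sq hg2 hhsq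
    simpa only [← pow_mul] using this
  have hg_sq : ∫ x, g x ^ 2 ∂Q ≤ (∫ x, f x ^ 2 ∂Q) - 1 := by
    rw [← integral_sub_one_sq hf hf0 hP]
    refine integral_mono hg2.integrable_sq (hf.sub (memLp_const 1)).integrable_sq fun x => ?_
    simp only [hg_def]
    rcases le_total (f x - 1) 0 with hx | hx
    · simp [hx, sq_nonneg]
    · simp [hx]
  have hgtv : ∫ x, g x ∂Q ≤ tvDist P Q := integral_posPart_le_tvDist hfm hfi hf0 hP
  have hgI : 0 ≤ ∫ x, g x ∂Q := integral_nonneg hg0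
  calc ((∫ x, f x * h x ∂Q) - ∫ x, h x ∂Q) ^ 4
      ≤ (∫ x, g x * h x ∂Q) ^ 4 := pow_le_pow_left₀ (sub_nonneg.2 hle) hfgh 4
    _ = ((∫ x, g x * h x ∂Q) ^ 2) ^ 2 := by ring
    _ ≤ ((∫ x, g x ∂Q) * ∫ x, g x * h x ^ 2 ∂Q) ^ 2 := pow_le_pow_left₀ (sq_nonneg _) hgh_sq 2
    _ = (∫ x, g x ∂Q) ^ 2 * (∫ x, g x * h x ^ 2 ∂Q) ^ 2 := mul_pow _ _ _
    _ ≤ tvDist P Q ^ 2 * (((∫ x, f x ^ 2 ∂Q) - 1) * ∫ x, h x ^ 4 ∂Q) := by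
      refine mul_le_mul (pow_le_pow_left₀ hgI hgtv 2) (hghh_sq.trans ?_) (sq_nonneg _) (sq_nonneg _)
      exact mul_le_mul_of_nonneg_right hg_sq (integral_nonneg fun x => by positivity)

end Density

/-! ### Gaussian product measures with a common mean -/

section Gaussian

open scoped NNReal

theorem pi_withDensity_ofReal {ι : Type*} [Fintype ι] {E : ι → Type*}
    [∀ i, MeasurableSpace (E i)] {ν : ∀ i, Measure (E i)} [∀ i, IsFiniteMeasure (ν i)]
    {f : ∀ i, E i → ℝ} (hf : ∀ i, Integrable (f i) (ν i)) (hf0 : ∀ i x, 0 ≤ f i x) :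
    Measure.pi (fun i => (ν i).withDensity fun x => ENNReal.ofReal (f i x))
      = (Measure.pi ν).withDensity fun x => ENNReal.ofReal (∏ i, f i (x i)) := by
  have : ∀ i, IsFiniteMeasure ((ν i).withDensity fun x => ENNReal.ofReal (f i x)) := fun i =>
    isFiniteMeasure_withDensity_ofReal (hf i).2
  refine Measure.pi_eq fun s hs => ?_
  have hind : ∀ x : ∀ i, E i, (Set.univ.pi s).indicator (fun x => ∏ i, f i (x i)) x
      = ∏ i, (s i).indicator (f i) (x i) := fun x => by
    by_cases hx : x ∈ Set.univ.pi s
    · rw [Set.indicator_of_mem hx]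
      exact Finset.prod_congr rfl fun i _ => (Set.indicator_of_mem (hx i trivial) _).symm
    · rw [Set.indicator_of_notMem hx]
      obtain ⟨i, hi⟩ : ∃ i, x i ∉ s i := by simpa using hx
      exact (Finset.prod_eq_zero (Finset.mem_univ i) (Set.indicator_of_notMem hi _)).symm
  have hint : Integrable (fun x : ∀ i, E i => ∏ i, f i (x i)) (Measure.pi ν) :=
    Integrable.fintype_prod_dep hf
  rw [withDensity_apply _ (MeasurableSet.univ_pi hs),
    ← ofReal_integral_eq_lintegral_ofReal hint.restrict
      (ae_of_all _ fun x => Finset.prod_nonneg fun i _ => hf0 i _),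
    ← integral_indicator (MeasurableSet.univ_pi hs), integral_congr_ae (ae_of_all _ hind),
    integral_fintype_prod_eq_prod,
    ENNReal.ofReal_prod_of_nonneg fun i _ =>
      integral_nonneg fun x => Set.indicator_nonneg (fun y _ => hf0 i y) x]
  refine Finset.prod_congr rfl fun i _ => ?_
  rw [withDensity_apply _ (hs i), integral_indicator (hs i),
    ofReal_integral_eq_lintegral_ofReal (hf i).restrict (ae_of_all _ (hf0 i))]

variable {m : ℝ} {v w : ℝ≥0} {r s : ℝ}

theorem ne_zero_of_coe_eq_mul_one_add (hv : v ≠ 0) (hr : 0 ≤ r) (hw : (w : ℝ) = v * (1 + r)) :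
    w ≠ 0 := by
  rw [← NNReal.coe_ne_zero, hw]
  exact mul_ne_zero (NNReal.coe_ne_zero.2 hv) (by positivity)

theorem gaussianReal_eq_withDensity (hv : v ≠ 0) (hr : 0 ≤ r) (hw : (w : ℝ) = v * (1 + r)) :
    gaussianReal m v = (gaussianReal m w).withDensity fun x =>
      ENNReal.ofReal (√(1 + r) * Real.exp (-r * ((x - m) ^ 2 / (2 * w)))) := by
  have hv' : (0 : ℝ) < v := NNReal.coe_pos.2 (pos_iff_ne_zero.2 hv)
  have hw0 : w ≠ 0 := ne_zero_of_coe_eq_mul_one_add hv hr hw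
  rw [gaussianReal_of_var_ne_zero _ hv, gaussianReal_of_var_ne_zero _ hw0,
    ← withDensity_mul _ (measurable_gaussianPDF _ _) (by fun_prop)]
  congr 1
  ext x
  rw [Pi.mul_apply, gaussianPDF, gaussianPDF, ← ENNReal.ofReal_mul (gaussianPDFReal_nonneg _ _ _),
    gaussianPDFReal, gaussianPDFReal]
  congr 1
  have h1 : √(2 * Real.pi * w) = √(2 * Real.pi * v) * √(1 + r) := by
    rw [← Real.sqrt_mul (by positivity), hw, mul_assoc (2 * Real.pi)]
  have h2 : -(x - m) ^ 2 / (2 * v) = -(x - m) ^ 2 / (2 * w) + -r * ((x - m) ^ 2 / (2 * w)) := by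
    rw [hw]
    field_simp
    ring
  have h3 : √(1 + r) ≠ 0 := (Real.sqrt_pos.2 (by positivity)).ne'
  rw [h1, h2, Real.exp_add]
  field_simp

theorem integral_exp_neg_mul_sq_gaussianReal (hw : w ≠ 0) (hs : 0 ≤ s) :
    ∫ x, Real.exp (-s * ((x - m) ^ 2 / (2 * w))) ∂gaussianReal m w = (√(1 + s))⁻¹ := by
  have hw' : (0 : ℝ) < w := NNReal.coe_pos.2 (pos_iff_ne_zero.2 hw)
  rw [integral_gaussianReal_eq_integral_smul hw]
  have h1 : ∀ x, gaussianPDFReal m w x • Real.exp (-s * ((x - m) ^ 2 / (2 * w)))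
      = (√(2 * Real.pi * w))⁻¹ * Real.exp (-((1 + s) / (2 * w)) * (x - m) ^ 2) := fun x => by
    rw [smul_eq_mul, gaussianPDFReal, mul_assoc, ← Real.exp_add]
    congr 2
    ring
  simp_rw [h1]
  rw [integral_const_mul,
    integral_sub_right_eq_self (fun x => Real.exp (-((1 + s) / (2 * w)) * x ^ 2)) m,
    integral_gaussian]
  have h2 : Real.pi / ((1 + s) / (2 * w)) = 2 * Real.pi * w / (1 + s) := by
    field_simp
  rw [h2, Real.sqrt_div (by positivity)]
  have h3 : √(2 * Real.pi * w) ≠ 0 := (Real.sqrt_pos.2 (by positivity)).ne'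
  field_simp

variable {d : ℕ} {μ : Fin d → ℝ}

/-- Half the squared distance to `μ`, in units of the variance `w`. -/
noncomputable def halfSqDist (μ : Fin d → ℝ) (w : ℝ≥0) (x : Fin d → ℝ) : ℝ :=
  ∑ i, (x i - μ i) ^ 2 / (2 * w)

theorem halfSqDist_nonneg (x : Fin d → ℝ) : 0 ≤ halfSqDist μ w x :=
  Finset.sum_nonneg fun _ _ => by positivity

theorem measurable_halfSqDist : Measurable (halfSqDist μ w) := by
  unfold halfSqDist
  fun_prop

theorem exp_neg_mul_halfSqDist (s : ℝ) (x : Fin d → ℝ) :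
    Real.exp (-s * halfSqDist μ w x) = ∏ i, Real.exp (-s * ((x i - μ i) ^ 2 / (2 * w))) := by
  rw [halfSqDist, Finset.mul_sum, Real.exp_sum]

theorem integral_exp_neg_mul_halfSqDist (hw : w ≠ 0) (hs : 0 ≤ s) :
    ∫ x, Real.exp (-s * halfSqDist μ w x) ∂Measure.pi (fun i => gaussianReal (μ i) w)
      = (√(1 + s))⁻¹ ^ d := by
  simp_rw [exp_neg_mul_halfSqDist]
  rw [integral_fintype_prod_eq_prod
    (fun i (y : ℝ) => Real.exp (-s * ((y - μ i) ^ 2 / (2 * w))))]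
  simp only [integral_exp_neg_mul_sq_gaussianReal hw hs, Finset.prod_const, Finset.card_univ,
    Fintype.card_fin]

theorem pi_gaussianReal_eq_withDensity (hv : v ≠ 0) (hr : 0 ≤ r) (hw : (w : ℝ) = v * (1 + r)) :
    Measure.pi (fun i => gaussianReal (μ i) v)
      = (Measure.pi fun i => gaussianReal (μ i) w).withDensity fun x =>
        ENNReal.ofReal (√(1 + r) ^ d * Real.exp (-r * halfSqDist μ w x)) := by
  have hint : ∀ i, Integrable (fun x => √(1 + r) * Real.exp (-r * ((x - μ i) ^ 2 / (2 * w))))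
      (gaussianReal (μ i) w) := fun i => by
    refine Integrable.of_bound (by fun_prop) (√(1 + r)) (ae_of_all _ fun x => ?_)
    rw [Real.norm_of_nonneg (by positivity)]
    refine mul_le_of_le_one_right (Real.sqrt_nonneg _) (Real.exp_le_one_iff.2 ?_)
    rw [neg_mul]
    exact neg_nonpos.2 (by positivity)
  simp_rw [gaussianReal_eq_withDensity hv hr hw]
  rw [pi_withDensity_ofReal hint fun i x => by positivity]
  simp_rw [Finset.prod_mul_distrib, exp_neg_mul_halfSqDist]
  simp

end Gaussian

/-! ### Elementary inequalities -/

section Inequalities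

theorem one_add_mul_inv_sqrt_le_exp {r : ℝ} (hr : 0 ≤ r) :
    (1 + r) * (√(1 + 2 * r))⁻¹ ≤ Real.exp (r ^ 2 / 2) := by
  refine (pow_le_pow_iff_left₀ (by positivity) (Real.exp_pos _).le two_ne_zero).1 ?_
  rw [mul_pow, inv_pow, Real.sq_sqrt (by positivity), ← Real.exp_nat_mul]
  have h : (2 : ℕ) * (r ^ 2 / 2) = r ^ 2 := by push_cast; ring
  rw [h, mul_inv_le_iff₀ (by positivity)]
  have := Real.add_one_le_exp (r ^ 2)
  nlinarith [pow_nonneg hr 3]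

theorem sqrt_sqrt_mul_inv_sqrt_le_exp {r : ℝ} (hr : 0 ≤ r) :
    √(√(1 + r)) * (√(1 + r / 2))⁻¹ ≤ Real.exp (-(r ^ 2 / (4 * (2 + r) ^ 2))) := by
  refine (pow_le_pow_iff_left₀ (by positivity) (Real.exp_pos _).le four_ne_zero).1 ?_
  have h1 : √(√(1 + r)) ^ 4 = 1 + r := by
    rw [show (4 : ℕ) = 2 * 2 from rfl, pow_mul, Real.sq_sqrt (Real.sqrt_nonneg _),
      Real.sq_sqrt (by positivity)]
  have h2 : √(1 + r / 2) ^ 4 = (1 + r / 2) ^ 2 := by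
    rw [show (4 : ℕ) = 2 * 2 from rfl, pow_mul, Real.sq_sqrt (by positivity)]
  rw [mul_pow, inv_pow, h1, h2, ← Real.exp_nat_mul]
  have h3 : (4 : ℕ) * -(r ^ 2 / (4 * (2 + r) ^ 2)) = -(r ^ 2 / (2 + r) ^ 2) := by
    push_cast
    field_simp
  have h4 : (1 + r) * ((1 + r / 2) ^ 2)⁻¹ = 1 - r ^ 2 / (2 + r) ^ 2 := by
    field_simp
    ring
  rw [h3, h4]
  exact Real.one_sub_le_exp_neg _

theorem inv_sqrt_le_exp_mul_inv_sqrt_pow {t : ℝ} (ht : 0 ≤ t) (ht1 : t ≤ 1) :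
    (√(1 + 4 * t))⁻¹ ≤ Real.exp (3 * t ^ 2) * (√(1 + t))⁻¹ ^ 4 := by
  have h1 : √(1 + t) ^ 4 = (1 + t) ^ 2 := by
    rw [show (4 : ℕ) = 2 * 2 from rfl, pow_mul, Real.sq_sqrt (by positivity)]
  rw [inv_pow, h1]
  refine (pow_le_pow_iff_left₀ (by positivity) (by positivity) two_ne_zero).1 ?_
  rw [mul_pow, inv_pow, inv_pow, Real.sq_sqrt (by positivity), ← Real.exp_nat_mul]
  have h2 : (2 : ℕ) * (3 * t ^ 2) = 6 * t ^ 2 := by push_cast; ring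
  rw [h2, ← div_eq_mul_inv, le_div_iff₀ (by positivity), inv_mul_le_iff₀ (by positivity)]
  have h3 := Real.add_one_le_exp (6 * t ^ 2)
  have h4 : 0 ≤ t ^ 3 * (20 - t) := mul_nonneg (by positivity) (by linarith)
  nlinarith

theorem one_add_le_sqrt_pow {r t : ℝ} (hr : 0 ≤ r) (ht : 0 ≤ t) {d : ℕ} {y : ℝ} (hy : 0 ≤ y)
    (h : (1 + y) ^ 2 ≤ 1 + d * (t * r / (1 + r + t))) :
    (1 + y) * (√(1 + t))⁻¹ ^ d ≤ √(1 + r) ^ d * (√(1 + (r + t)))⁻¹ ^ d := by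
  rw [← mul_pow, inv_pow, mul_inv_le_iff₀ (by positivity), ← mul_pow]
  refine (pow_le_pow_iff_left₀ (by positivity) (by positivity) two_ne_zero).1 ?_
  rw [pow_right_comm, mul_pow (√(1 + r) * _), mul_pow (√(1 + r)), inv_pow,
    Real.sq_sqrt (by positivity), Real.sq_sqrt (by positivity), Real.sq_sqrt (by positivity)]
  have h1 : (1 + r) * (1 + (r + t))⁻¹ * (1 + t) = 1 + t * r / (1 + r + t) := by
    field_simp
    ring
  rw [h1]
  exact h.trans (one_add_mul_le_pow (by
    have : 0 ≤ t * r / (1 + r + t) := by positivity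
    linarith) d)

end Inequalities

section GaussianTV

open scoped NNReal

variable {d : ℕ} {μ : Fin d → ℝ} {v w : ℝ≥0} {r : ℝ}

theorem exp_neg_mul_halfSqDist_le_one (hr : 0 ≤ r) (x : Fin d → ℝ) :
    Real.exp (-r * halfSqDist μ w x) ≤ 1 :=
  Real.exp_le_one_iff.2 (by
    rw [neg_mul]
    exact neg_nonpos.2 (mul_nonneg hr (halfSqDist_nonneg x)))

theorem measurable_exp_neg_mul_halfSqDist :
    Measurable fun x : Fin d → ℝ => Real.exp (-r * halfSqDist μ w x) :=
  (measurable_halfSqDist.const_mul _).exp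

theorem memLp_density (hr : 0 ≤ r) {p : ENNReal} :
    MemLp (fun x => √(1 + r) ^ d * Real.exp (-r * halfSqDist μ w x)) p
      (Measure.pi fun i => gaussianReal (μ i) w) := by
  refine MemLp.of_bound (measurable_exp_neg_mul_halfSqDist.const_mul _).aestronglyMeasurable
    (√(1 + r) ^ d) (ae_of_all _ fun x => ?_)
  rw [Real.norm_of_nonneg (by positivity)]
  exact mul_le_of_le_one_right (by positivity) (exp_neg_mul_halfSqDist_le_one hr x)

theorem integral_density_sq_le (hw : w ≠ 0) (hr : 0 ≤ r) :
    ∫ x, (√(1 + r) ^ d * Real.exp (-r * halfSqDist μ w x)) ^ 2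
      ∂Measure.pi (fun i => gaussianReal (μ i) w) ≤ Real.exp ((r * √d) ^ 2 / 2) := by
  have h1 : ∀ x, (√(1 + r) ^ d * Real.exp (-r * halfSqDist μ w x)) ^ 2
      = (1 + r) ^ d * Real.exp (-(2 * r) * halfSqDist μ w x) := fun x => by
    rw [mul_pow, pow_right_comm, Real.sq_sqrt (by positivity), ← Real.exp_nat_mul]
    push_cast
    ring_nf
  simp_rw [h1]
  rw [integral_const_mul, integral_exp_neg_mul_halfSqDist hw (by positivity), ← mul_pow]
  refine (pow_le_pow_left₀ (by positivity) (one_add_mul_inv_sqrt_le_exp hr) d).trans_eq ?_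
  rw [← Real.exp_nat_mul, mul_pow, Real.sq_sqrt (Nat.cast_nonneg d)]
  ring_nf

theorem integral_density_sq_sub_one_le (hw : w ≠ 0) (hr : 0 ≤ r) (hL : r * √d ≤ 1) :
    (∫ x, (√(1 + r) ^ d * Real.exp (-r * halfSqDist μ w x)) ^ 2
      ∂Measure.pi (fun i => gaussianReal (μ i) w)) - 1 ≤ (r * √d) ^ 2 := by
  have h0 : 0 ≤ r * √d := by positivity
  have hL2 : (r * √d) ^ 2 ≤ 1 := pow_le_one₀ h0 hL
  have h1 : |(r * √d) ^ 2 / 2| ≤ 1 := by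
    rw [abs_of_nonneg (by positivity)]
    linarith
  have h2 := (abs_le.1 (Real.abs_exp_sub_one_sub_id_le h1)).2
  have h3 := integral_density_sq_le (d := d) (μ := μ) hw hr
  nlinarith [sq_nonneg (r * √d)]

theorem tvDist_pi_gaussianReal_le (hv : v ≠ 0) (hr : 0 ≤ r) (hw : (w : ℝ) = v * (1 + r)) :
    tvDist (Measure.pi fun i => gaussianReal (μ i) v) (Measure.pi fun i => gaussianReal (μ i) w)
      ≤ 3 / 2 * min 1 (r * √d) := by
  have hw0 : w ≠ 0 := ne_zero_of_coe_eq_mul_one_add hv hr hw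
  have h0 : 0 ≤ r * √d := by positivity
  rcases le_total (r * √d) 1 with hL | hL
  · rw [min_eq_right hL]
    have h1 := tvDist_le_sqrt_integral_sq_sub_one (memLp_density hr) (fun x => by positivity)
      (pi_gaussianReal_eq_withDensity (μ := μ) hv hr hw)
    have h2 := Real.sqrt_le_sqrt (integral_density_sq_sub_one_le (μ := μ) hw0 hr hL)
    rw [Real.sqrt_sq h0] at h2
    linarith
  · rw [min_eq_left hL]
    exact tvDist_le_one.trans (by norm_num)

theorem le_tvDist_pi_gaussianReal_of_le (hv : v ≠ 0) (hr : 0 ≤ r) (hw : (w : ℝ) = v * (1 + r))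
    (hL : 1 / 4 ≤ r * √d) :
    1 / 100 * min 1 (r * √d) ≤ tvDist (Measure.pi fun i => gaussianReal (μ i) v)
      (Measure.pi fun i => gaussianReal (μ i) w) := by
  have hw0 : w ≠ 0 := ne_zero_of_coe_eq_mul_one_add hv hr hw
  have hd : 1 ≤ √(d : ℝ) := by
    refine Real.one_le_sqrt.2 (Nat.one_le_cast.2 (Nat.one_le_iff_ne_zero.2 ?_))
    rintro rfl
    norm_num at hL
  have key := one_sub_integral_sqrt_le_tvDist (measurable_exp_neg_mul_halfSqDist.const_mul _)
    ((memLp_density hr).integrable le_rfl) (fun x => by positivity)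
    (pi_gaussianReal_eq_withDensity (μ := μ) hv hr hw)
  have h1 : ∀ x, √(√(1 + r) ^ d * Real.exp (-r * halfSqDist μ w x))
      = √(√(1 + r)) ^ d * Real.exp (-(r / 2) * halfSqDist μ w x) := fun x => by
    rw [Real.sqrt_eq_iff_mul_self_eq (by positivity) (by positivity), mul_mul_mul_comm, ← mul_pow,
      Real.mul_self_sqrt (Real.sqrt_nonneg _), ← Real.exp_add]
    ring_nf
  simp_rw [h1] at key
  rw [integral_const_mul, integral_exp_neg_mul_halfSqDist hw0 (by positivity), ← mul_pow] at key
  have h2 := pow_le_pow_left₀ (by positivity) (sqrt_sqrt_mul_inv_sqrt_le_exp hr) d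
  set L := r * √d with hLdef
  have hrL : r ≤ L := le_mul_of_one_le_right hr hd
  have hL2 : L ^ 2 = d * r ^ 2 := by
    rw [hLdef, mul_pow, Real.sq_sqrt (Nat.cast_nonneg d), mul_comm]
  have h3 : Real.exp (-(r ^ 2 / (4 * (2 + r) ^ 2))) ^ d
      ≤ Real.exp (-(L ^ 2 / (4 * (2 + L) ^ 2))) := by
    rw [← Real.exp_nat_mul, Real.exp_le_exp, mul_neg, neg_le_neg_iff, ← mul_div_assoc, ← hL2]
    gcongr
  have h4 : Real.exp (-(L ^ 2 / (4 * (2 + L) ^ 2))) ≤ (1 + L ^ 2 / (4 * (2 + L) ^ 2))⁻¹ := by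
    rw [Real.exp_neg]
    refine inv_anti₀ (by positivity) ?_
    rw [add_comm]
    exact Real.add_one_le_exp _
  have h5 : (1 + L ^ 2 / (4 * (2 + L) ^ 2))⁻¹ = 1 - L ^ 2 / (4 * (2 + L) ^ 2 + L ^ 2) := by
    field_simp
    ring
  have h6 : 1 / 100 * min 1 L ≤ L ^ 2 / (4 * (2 + L) ^ 2 + L ^ 2) := by
    rw [le_div_iff₀ (by positivity)]
    rcases le_total L 1 with h | h
    · rw [min_eq_right h]
      nlinarith [mul_nonneg (sub_nonneg.2 hL) (sub_nonneg.2 h)]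
    · rw [min_eq_left h]
      nlinarith
  linarith

theorem le_tvDist_pi_gaussianReal_of_ge (hv : v ≠ 0) (hr : 0 ≤ r) (hw : (w : ℝ) = v * (1 + r))
    (hd : 1 ≤ d) (hL : r * √d ≤ 1 / 4) :
    1 / 100 * (r * √d) ≤ tvDist (Measure.pi fun i => gaussianReal (μ i) v)
      (Measure.pi fun i => gaussianReal (μ i) w) := by
  have hw0 : w ≠ 0 := ne_zero_of_coe_eq_mul_one_add hv hr hw
  have hd1 : 1 ≤ √(d : ℝ) := Real.one_le_sqrt.2 (Nat.one_le_cast.2 hd)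
  have hdsq : √(d : ℝ) ^ 2 = d := Real.sq_sqrt (Nat.cast_nonneg d)
  set t : ℝ := 1 / (2 * √d) with htdef
  have ht : 0 ≤ t := by positivity
  have ht2 : t ≤ 1 / 2 := by
    rw [htdef]
    gcongr
    linarith
  have hdt : d * t = √d / 2 := by
    rw [htdef]
    field_simp
    exact hdsq.symm
  have hdt2 : d * t ^ 2 = 1 / 4 := by
    rw [htdef, div_pow, mul_pow, hdsq]
    field_simp
    norm_num
  set L := r * √d with hLdef
  have hL0 : 0 ≤ L := by positivity
  have hrL : r ≤ L := le_mul_of_one_le_right hr hd1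
  set Q := Measure.pi fun i => gaussianReal (μ i) w with hQ
  set F : ℝ := (√(1 + t))⁻¹ ^ d with hF
  have hF0 : 0 < F := by positivity
  have hI1 : ∫ x, Real.exp (-t * halfSqDist μ w x) ∂Q = F :=
    integral_exp_neg_mul_halfSqDist hw0 ht
  have hI2 : (1 + L / 8) * F ≤ ∫ x, √(1 + r) ^ d * Real.exp (-r * halfSqDist μ w x)
      * Real.exp (-t * halfSqDist μ w x) ∂Q := by
    have h1 : ∀ x, √(1 + r) ^ d * Real.exp (-r * halfSqDist μ w x)
        * Real.exp (-t * halfSqDist μ w x)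
        = √(1 + r) ^ d * Real.exp (-(r + t) * halfSqDist μ w x) := fun x => by
      rw [mul_assoc, ← Real.exp_add]
      ring_nf
    simp_rw [h1]
    rw [integral_const_mul, integral_exp_neg_mul_halfSqDist hw0 (by positivity)]
    refine one_add_le_sqrt_pow hr ht (by positivity) ?_
    have h2 : L / 2 / (7 / 4) ≤ d * (t * r / (1 + r + t)) := by
      rw [← mul_div_assoc, ← mul_assoc, hdt, div_mul_eq_mul_div, mul_comm (√(d : ℝ)), ← hLdef]
      gcongr
      linarith
    nlinarith
  have hI3 : ∫ x, Real.exp (-t * halfSqDist μ w x) ^ 4 ∂Q ≤ 9 / 4 * F ^ 4 := by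
    have h1 : ∀ x, Real.exp (-t * halfSqDist μ w x) ^ 4
        = Real.exp (-(4 * t) * halfSqDist μ w x) := fun x => by
      rw [← Real.exp_nat_mul]
      push_cast
      ring_nf
    simp_rw [h1]
    rw [integral_exp_neg_mul_halfSqDist hw0 (by positivity)]
    refine (pow_le_pow_left₀ (by positivity)
      (inv_sqrt_le_exp_mul_inv_sqrt_pow ht (by linarith)) d).trans ?_
    rw [mul_pow, hF, pow_right_comm, ← Real.exp_nat_mul]
    refine mul_le_mul_of_nonneg_right ?_ (by positivity)
    rw [mul_left_comm, hdt2]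
    have h2 : Real.exp (3 * (1 / 4)) ^ 4 ≤ (9 / 4) ^ 4 := by
      rw [← Real.exp_nat_mul]
      have h3 := Real.exp_one_lt_d9
      calc Real.exp ((4 : ℕ) * (3 * (1 / 4))) = Real.exp 1 ^ 3 := by
            rw [← Real.exp_nat_mul]
            norm_num
        _ ≤ 2.7182818286 ^ 3 := pow_le_pow_left₀ (Real.exp_pos _).le h3.le 3
        _ ≤ (9 / 4) ^ 4 := by norm_num
    exact (pow_le_pow_iff_left₀ (Real.exp_pos _).le (by norm_num) four_ne_zero).1 h2
  have hX := integral_density_sq_sub_one_le (μ := μ) hw0 hr (hL.trans (by norm_num))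
  have key := pow_four_integral_sub_le_tvDist_sq_mul (C := √(1 + r) ^ d) (D := 1)
    (measurable_exp_neg_mul_halfSqDist.const_mul _)
    (measurable_exp_neg_mul_halfSqDist (r := t) (μ := μ) (w := w)) (fun x => by positivity)
    (fun x => mul_le_of_le_one_right (by positivity) (exp_neg_mul_halfSqDist_le_one hr x))
    (fun x => (Real.exp_pos _).le) (fun x => exp_neg_mul_halfSqDist_le_one ht x)
    (pi_gaussianReal_eq_withDensity (μ := μ) hv hr hw)
    (by
      rw [← hQ, hI1]
      exact (le_mul_of_one_le_left hF0.le (by linarith)).trans hI2)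
  rw [← hQ, hI1] at key
  set TV := tvDist (Measure.pi fun i => gaussianReal (μ i) v) Q with hTV
  have hTV0 : 0 ≤ TV := Real.iSup_nonneg fun _ => abs_nonneg _
  have h1 : (L / 8 * F) ^ 4 ≤ TV ^ 2 * (L ^ 2 * (9 / 4 * F ^ 4)) := by
    refine (pow_le_pow_left₀ (by positivity) (by linarith) 4).trans (key.trans ?_)
    refine mul_le_mul_of_nonneg_left ?_ (sq_nonneg _)
    exact mul_le_mul hX hI3 (integral_nonneg fun x => by positivity) (sq_nonneg _)
  rcases hL0.eq_or_lt with h | hLpos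
  · rw [← h, mul_zero]
    exact hTV0
  refine (pow_le_pow_iff_left₀ (by positivity) hTV0 two_ne_zero).1 ?_
  refine le_of_mul_le_mul_right ?_ (show 0 < L ^ 2 * F ^ 4 by positivity)
  have : 0 ≤ L ^ 4 * F ^ 4 := by positivity
  nlinarith

end GaussianTV

theorem randomization_privacy_leakage
    (d : ℕ) (hd : 1 ≤ d) (μ : Fin d → ℝ) (c σ : ℝ) (hc : 0 < c) (hσ : 0 < σ)
    (P Q : Measure (Fin d → ℝ))
    (hP : P = Measure.pi fun i => gaussianReal (μ i) ⟨c ^ 2, sq_nonneg _⟩)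
    (hQ : Q = Measure.pi fun i => gaussianReal (μ i)
      ⟨c ^ 2 + σ ^ 2, by positivity⟩)
    (εp : ℝ) (hεp : εp = 1 - tvDist P Q) :
    ((1 / 100) * min 1 (σ ^ 2 / c ^ 2 * Real.sqrt d) ≤ tvDist P Q ∧
      tvDist P Q ≤ (3 / 2) * min 1 (σ ^ 2 / c ^ 2 * Real.sqrt d)) ∧
    (1 - (3 / 2) * min 1 (σ ^ 2 / c ^ 2 * Real.sqrt d) ≤ εp ∧
      εp ≤ 1 - (1 / 100) * min 1 (σ ^ 2 / c ^ 2 * Real.sqrt d)) := by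
  have hv : (⟨c ^ 2, sq_nonneg _⟩ : NNReal) ≠ 0 := fun h =>
    (pow_pos hc 2).ne' (congrArg NNReal.toReal h)
  have hr : 0 ≤ σ ^ 2 / c ^ 2 := by positivity
  have hw : ((⟨c ^ 2 + σ ^ 2, by positivity⟩ : NNReal) : ℝ)
      = (⟨c ^ 2, sq_nonneg _⟩ : NNReal) * (1 + σ ^ 2 / c ^ 2) := by
    change c ^ 2 + σ ^ 2 = c ^ 2 * (1 + σ ^ 2 / c ^ 2)
    field_simp
  have upper : tvDist P Q ≤ (3 / 2) * min 1 (σ ^ 2 / c ^ 2 * Real.sqrt d) := by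
    rw [hP, hQ]
    exact tvDist_pi_gaussianReal_le hv hr hw
  have lower : (1 / 100) * min 1 (σ ^ 2 / c ^ 2 * Real.sqrt d) ≤ tvDist P Q := by
    rw [hP, hQ]
    rcases le_total (1 / 4) (σ ^ 2 / c ^ 2 * Real.sqrt d) with h | h
    · exact le_tvDist_pi_gaussianReal_of_le hv hr hw h
    · rw [min_eq_right (h.trans (by norm_num))]
      exact le_tvDist_pi_gaussianReal_of_ge hv hr hw hd h
  exact ⟨⟨lower, upper⟩, by linarith, by linarith⟩
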